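/- Let g be a finite-dimensional complex Lie algebra and e ∈ g an element such that ad e is a nilpotent endomorphism of g. Let ι : g → U(g) be the canonical map into the universal enveloping algebra. Then the powers of ι(e) satisfy the left Ore condition: for every u ∈ U(g) and every n ∈ ℕ there exist m ∈ ℕ and v ∈ U(g) such that ι(e)^m · u = v · ι(e)^n. -/

import Mathlib

section LeftOre

attribute [local instance] LieRing.ofAssociativeRing

variable {R A : Type*} [CommRing R] [Ring A] [Algebra R A]

/-- The elements `u` that satisfy the left Ore condition with respect to the powers of `s`
form a subalgebra. -/
def leftOreSubalgebra (R : Type*) {A : Type*} [CommRing R] [Ring A] [Algebra R A] (s : A) :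
    Subalgebra R A where
  carrier := {u | ∀ n : ℕ, ∃ (m : ℕ) (v : A), s ^ m * u = v * s ^ n}
  mul_mem' {a b} ha hb n := by
    obtain ⟨m, v, hv⟩ := hb n
    obtain ⟨k, w, hw⟩ := ha m
    exact ⟨k, w * v, by rw [← mul_assoc, hw, mul_assoc, hv, mul_assoc]⟩
  add_mem' {a b} ha hb n := by
    obtain ⟨m, v, hv⟩ := ha n
    obtain ⟨k, w, hw⟩ := hb n
    refine ⟨k + m, s ^ k * v + s ^ m * w, ?_⟩
    rw [mul_add, add_mul, pow_add, mul_assoc, hv, ← pow_add, add_comm k m, pow_add, mul_assoc,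
      hw, mul_assoc, mul_assoc]
  algebraMap_mem' r n := ⟨n, algebraMap R A r, (Algebra.commutes r (s ^ n)).symm⟩

theorem mem_leftOreSubalgebra {s u : A} :
    u ∈ leftOreSubalgebra R s ↔ ∀ n : ℕ, ∃ (m : ℕ) (v : A), s ^ m * u = v * s ^ n :=
  Iff.rfl

theorem mem_leftOreSubalgebra_of_lie_mem {s a : A} (h : ⁅s, a⁆ ∈ leftOreSubalgebra R s) :
    a ∈ leftOreSubalgebra R s := by
  intro n
  induction n with
  | zero => exact ⟨0, a, by simp⟩
  | succ n ih =>
    obtain ⟨k, w, hw⟩ := ih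
    obtain ⟨m, v, hv⟩ := h (n + 1)
    refine ⟨m + k + 1, s ^ m * w + s ^ k * v, ?_⟩
    calc s ^ (m + k + 1) * a = s ^ m * (s ^ k * a) * s + s ^ k * (s ^ m * ⁅s, a⁆) := by
          simp only [← mul_assoc, ← pow_add, add_comm k m, pow_succ, Ring.lie_def, mul_sub]
          abel
      _ = (s ^ m * w + s ^ k * v) * s ^ (n + 1) := by
          rw [hw, hv, pow_succ]
          noncomm_ring

theorem LieHom.mem_leftOreSubalgebra_of_ad_pow_eq_zero {L : Type*} [LieRing L] [LieAlgebra R L]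
    (f : L →ₗ⁅R⁆ A) (e : L) (k : ℕ) (x : L) (hx : (LieAlgebra.ad R L e ^ k) x = 0) :
    f x ∈ leftOreSubalgebra R (f e) := by
  induction k generalizing x with
  | zero =>
    have hx : x = 0 := by simpa using hx
    simp [hx]
  | succ k ih =>
    refine mem_leftOreSubalgebra_of_lie_mem ?_
    rw [← LieHom.map_lie]
    exact ih _ (by simpa [pow_succ] using hx)

theorem UniversalEnvelopingAlgebra.mem_of_forall_ι_mem {L : Type*} [LieRing L] [LieAlgebra R L]
    (S : Subalgebra R (UniversalEnvelopingAlgebra R L))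
    (hS : ∀ x : L, UniversalEnvelopingAlgebra.ι R x ∈ S) (u : UniversalEnvelopingAlgebra R L) :
    u ∈ S := by
  let f : L →ₗ⁅R⁆ S :=
    { (UniversalEnvelopingAlgebra.ι R : L →ₗ⁅R⁆ _).toLinearMap.codRestrict S.toSubmodule hS with
      map_lie' := fun {x y} => Subtype.ext (LieHom.map_lie (UniversalEnvelopingAlgebra.ι R) x y) }
  have h : S.val.comp (UniversalEnvelopingAlgebra.lift R f) = AlgHom.id R _ := by
    ext x
    exact congrArg Subtype.val (UniversalEnvelopingAlgebra.lift_ι_apply R f x)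
  have hu : (UniversalEnvelopingAlgebra.lift R f u : UniversalEnvelopingAlgebra R L) = u :=
    DFunLike.congr_fun h u
  exact hu ▸ (UniversalEnvelopingAlgebra.lift R f u).2

end LeftOre

/-- If `ad e` is nilpotent for an element `e` of a finite-dimensional complex Lie
algebra `g`, then the powers of `ι(e)` in the universal enveloping algebra `U(g)`
satisfy the left Ore condition: for every `u ∈ U(g)` and `n ∈ ℕ` there are
`m ∈ ℕ` and `v ∈ U(g)` with `ι(e)^m · u = v · ι(e)^n`. -/
theorem powers_of_ad_nilpotent_element_satisfy_ore_condition
    (g : Type*) [LieRing g] [LieAlgebra ℂ g] [FiniteDimensional ℂ g]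
    (e : g) (he : IsNilpotent (LieAlgebra.ad ℂ g e)) :
    ∀ (u : UniversalEnvelopingAlgebra ℂ g) (n : ℕ),
      ∃ (m : ℕ) (v : UniversalEnvelopingAlgebra ℂ g),
        (UniversalEnvelopingAlgebra.ι ℂ e) ^ m * u
          = v * (UniversalEnvelopingAlgebra.ι ℂ e) ^ n := by
  obtain ⟨k, hk⟩ := he
  intro u
  refine mem_leftOreSubalgebra.1
    (UniversalEnvelopingAlgebra.mem_of_forall_ι_mem (leftOreSubalgebra ℂ _) (fun x => ?_) u)
  exact LieHom.mem_leftOreSubalgebra_of_ad_pow_eq_zero _ e k x (by rw [hk, LinearMap.zero_apply])
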